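/- arXiv:2505.20689 — 2 statements merged into one kernel-verified Lean document; each statement's English description precedes it below -/
import Mathlib

section
/- For every T ≥ 1 the control operator W^T : ℂ^T → ℂ^T, f ↦ ((W^T f)_n)_{n=1}^T with (W^T f)_n = u^f_{n,T}, is a bijective ℂ-linear map (an isomorphism of ℂ^T). -/
open Finset Matrix

noncomputable section

/-- `IsWave a b f u` means `u` is the wave of the dynamical system with
off-diagonal coefficients `a = (a_n)_{n ≥ 0}`, diagonal coefficients
`b = (b_n)_{n ≥ 1}` and boundary control `f`:
`u_{n,-1} = u_{n,0} = 0` for `n ≥ 1`, `u_{0,t} = f_t` for `t ≥ 0`, and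
`u_{n,t+1} + u_{n,t-1} - a_n u_{n+1,t} - a_{n-1} u_{n-1,t} - b_n u_{n,t} = 0`
for `n ≥ 1`, `t ≥ 0`. -/
def IsWave (a b f : ℕ → ℂ) (u : ℕ → ℤ → ℂ) : Prop :=
  (∀ n : ℕ, 1 ≤ n → u n (-1) = 0) ∧
  (∀ n : ℕ, 1 ≤ n → u n 0 = 0) ∧
  (∀ t : ℕ, u 0 (t : ℤ) = f t) ∧
  (∀ n : ℕ, 1 ≤ n → ∀ t : ℤ, 0 ≤ t →
    u n (t + 1) + u n (t - 1) - a n * u (n + 1) t - a (n - 1) * u (n - 1) t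
      - b n * u n t = 0)

/-- The special control `δ = (1,0,0,…)`. -/
def deltaCtrl : ℕ → ℂ := fun t => if t = 0 then 1 else 0

/-- Extension of a control `f ∈ ℂ^T` by zero to all of `ℕ`. -/
def extendCtrl (T : ℕ) (f : Fin T → ℂ) : ℕ → ℂ :=
  fun t => if h : t < T then f ⟨t, h⟩ else 0

/-- Waves depend linearly on their boundary control. -/
lemma IsWave.add_smul {a b f g : ℕ → ℂ} {u v : ℕ → ℤ → ℂ} (hu : IsWave a b f u)
    (hv : IsWave a b g v) (c : ℂ) :
    IsWave a b (fun t => f t + c * g t) (fun n t => u n t + c * v n t) := by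
  obtain ⟨hu₁, hu₂, hu₃, hu₄⟩ := hu
  obtain ⟨hv₁, hv₂, hv₃, hv₄⟩ := hv
  refine ⟨fun n hn => ?_, fun n hn => ?_, fun t => ?_, fun n hn t ht => ?_⟩
  · simp [hu₁ n hn, hv₁ n hn]
  · simp [hu₂ n hn, hv₂ n hn]
  · simp [hu₃ t, hv₃ t]
  · linear_combination hu₄ n hn t ht + c * hv₄ n hn t ht

/-- Finite propagation speed: a control vanishing before time `k` reaches the point `n` no
earlier than at time `n + k`. -/
lemma IsWave.eq_zero_of_lt {a b f : ℕ → ℂ} {u : ℕ → ℤ → ℂ} (hu : IsWave a b f u) {k : ℕ}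
    (hf : ∀ s < k, f s = 0) {n t : ℕ} (h : t < n + k) : u n t = 0 := by
  obtain ⟨hu₁, hu₂, hu₃, hu₄⟩ := hu
  induction t using Nat.strong_induction_on generalizing n with
  | _ t ih =>
    rcases n with _ | n
    · rw [hu₃ t, hf t (by omega)]
    rcases t with _ | t
    · exact hu₂ _ (by omega)
    have hprev : u (n + 1) ((t : ℤ) - 1) = 0 := by
      rcases t with _ | t
      · exact hu₁ _ (by omega)
      · simpa using ih t (by omega) (n := n + 1) (by omega)
    have hrec := hu₄ (n + 1) (by omega) t (by omega)
    rw [hprev, ih t (by omega) (n := n + 1 + 1) (by omega),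
      ih t (by omega) (n := n + 1) (by omega), Nat.add_sub_cancel,
      ih t (by omega) (n := n) (by omega)] at hrec
    push_cast
    simpa using hrec

/-- The value on the front of a wave whose control vanishes before time `k`. -/
lemma IsWave.apply_front {a b f : ℕ → ℂ} {u : ℕ → ℤ → ℂ} (hu : IsWave a b f u) {k : ℕ}
    (hf : ∀ s < k, f s = 0) (n : ℕ) :
    u n ((n + k : ℕ) : ℤ) = (∏ i ∈ range n, a i) * f k := by
  induction n with
  | zero => simp [hu.2.2.1 k]
  | succ n ih =>
    have hprev : u (n + 1) (((n + k : ℕ) : ℤ) - 1) = 0 := by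
      rcases h : n + k with _ | m
      · exact hu.1 _ (by omega)
      · simpa using hu.eq_zero_of_lt hf (n := n + 1) (t := m) (by omega)
    have hrec := hu.2.2.2 (n + 1) (by omega) ((n + k : ℕ) : ℤ) (by omega)
    rw [hprev, hu.eq_zero_of_lt hf (n := n + 1 + 1) (by omega),
      hu.eq_zero_of_lt hf (n := n + 1) (by omega), Nat.add_sub_cancel, ih] at hrec
    have hcast : ((n + 1 + k : ℕ) : ℤ) = ((n + k : ℕ) : ℤ) + 1 := by push_cast; ring
    rw [hcast, prod_range_succ]
    linear_combination hrec

/-- Waves with the same control agree at nonnegative times. -/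
lemma IsWave.unique {a b f : ℕ → ℂ} {u v : ℕ → ℤ → ℂ} (hu : IsWave a b f u)
    (hv : IsWave a b f v) (n t : ℕ) : u n t = v n t := by
  have h := (hu.add_smul hv (-1)).eq_zero_of_lt (k := t + 1) (n := n) (t := t)
    (fun s _ => by ring) (by omega)
  linear_combination h

/-- A control supported before time `T` whose wave vanishes at `1, …, T` at time `T` is zero. -/
lemma IsWave.control_eq_zero {a b f : ℕ → ℂ} {u : ℕ → ℤ → ℂ} (ha : ∀ n, a n ≠ 0)
    (hu : IsWave a b f u) {T : ℕ} (h : ∀ n, 1 ≤ n → n ≤ T → u n T = 0) {k : ℕ} (hk : k < T) :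
    f k = 0 := by
  induction k using Nat.strong_induction_on with
  | _ k ih =>
    have hfront := hu.apply_front (fun s hs => ih s hs (hs.trans hk)) (T - k)
    rw [Nat.sub_add_cancel hk.le, h _ (by omega) (by omega)] at hfront
    exact (mul_eq_zero.1 hfront.symm).resolve_left (prod_ne_zero_iff.2 fun i _ => ha i)

lemma extendCtrl_add_smul {T : ℕ} (f g : Fin T → ℂ) (c : ℂ) :
    extendCtrl T (f + c • g) = fun t => extendCtrl T f t + c * extendCtrl T g t := by
  funext t
  by_cases h : t < T <;> simp [extendCtrl, h]

/-- the control operator `W^T : ℂ^T → ℂ^T`, `(W^T f)_n = u^f_{n,T}`,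
is a bijective `ℂ`-linear map. -/
theorem control_operator_isomorphism
    (a b : ℕ → ℂ) (ha : ∀ n, a n ≠ 0)
    (U : (ℕ → ℂ) → ℕ → ℤ → ℂ) (hU : ∀ f, IsWave a b f (U f))
    (T : ℕ) (hT : 1 ≤ T)
    (W : (Fin T → ℂ) → Fin T → ℂ)
    (hW : ∀ (f : Fin T → ℂ) (n : Fin T),
      W f n = U (extendCtrl T f) ((n : ℕ) + 1) (T : ℤ)) :
    IsLinearMap ℂ W ∧ Function.Bijective W := by
  have key (f g : Fin T → ℂ) (c : ℂ) : W (f + c • g) = W f + c • W g := by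
    funext n
    have hw := (hU (extendCtrl T f)).add_smul (hU (extendCtrl T g)) c
    rw [← extendCtrl_add_smul] at hw
    simpa [hW] using (hU _).unique hw (n + 1) T
  have hzero : W 0 = 0 := by simpa using key 0 0 (-1)
  have hlin : IsLinearMap ℂ W :=
    ⟨fun f g => by simpa using key f g 1, fun c f => by simpa [hzero] using key 0 f c⟩
  have hinj : Function.Injective (hlin.mk' W) := by
    refine (injective_iff_map_eq_zero _).2 fun f hf => funext fun k => ?_
    have hk := (hU (extendCtrl T f)).control_eq_zero ha (T := T) (fun n hn hnT => by
      have h := congrFun hf ⟨n - 1, by omega⟩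
      simpa [hW, Nat.sub_add_cancel hn] using h) k.2
    simpa [extendCtrl] using hk
  exact ⟨hlin, hinj, LinearMap.injective_iff_surjective.1 hinj⟩
end
end

section
/- The connecting operator is complex symmetric: its matrix in the standard basis equals its transpose, (C^T)^τ = C^T; equivalently, the Hermitian adjoint of C^T equals the entrywise complex conjugate of C^T. -/
open Finset Matrix

noncomputable section

/-- The wave with given coefficients and control is unique at nonnegative times. -/
theorem IsWave.eq_of_isWave {a b f : ℕ → ℂ} {u v : ℕ → ℤ → ℂ}
    (hu : IsWave a b f u) (hv : IsWave a b f v) (t n : ℕ) : u n t = v n t := by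
  obtain ⟨hu₁, hu₀, huf, hur⟩ := hu
  obtain ⟨hv₁, hv₀, hvf, hvr⟩ := hv
  suffices h : (∀ n : ℕ, 1 ≤ n → u n ((t : ℤ) - 1) = v n ((t : ℤ) - 1)) ∧
      ∀ n : ℕ, u n t = v n t from h.2 n
  clear n
  induction t with
  | zero =>
    refine ⟨fun n hn => ?_, fun n => ?_⟩
    · simp [hu₁ n hn, hv₁ n hn]
    · rcases Nat.eq_zero_or_pos n with rfl | hn
      · rw [huf, hvf]
      · simp [hu₀ n hn, hv₀ n hn]
  | succ t ih =>
    obtain ⟨hprev, hcur⟩ := ih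
    refine ⟨fun n _ => by simpa using hcur n, fun n => ?_⟩
    rcases Nat.eq_zero_or_pos n with rfl | hn
    · rw [huf, hvf]
    · have h₁ := hur n hn t (Int.natCast_nonneg t)
      have h₂ := hvr n hn t (Int.natCast_nonneg t)
      rw [hprev n hn, hcur, hcur, hcur] at h₁
      push_cast
      linear_combination h₁ - h₂

/-- Entrywise conjugation maps waves to waves of the conjugate system. -/
theorem IsWave.of_conj {a b f : ℕ → ℂ} {v : ℕ → ℤ → ℂ}
    (hv : IsWave (fun n => (starRingEnd ℂ) (a n)) (fun n => (starRingEnd ℂ) (b n))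
      (fun t => (starRingEnd ℂ) (f t)) v) :
    IsWave a b f (fun n t => (starRingEnd ℂ) (v n t)) := by
  obtain ⟨h₁, h₀, hf, hr⟩ := hv
  refine ⟨fun n hn => by simp [h₁ n hn], fun n hn => by simp [h₀ n hn],
    fun t => by simp [hf t], fun n hn t ht => ?_⟩
  simpa using congrArg (starRingEnd ℂ) (hr n hn t ht)

theorem conj_extendCtrl_single (T : ℕ) (i : Fin T) (t : ℕ) :
    (starRingEnd ℂ) (extendCtrl T (Pi.single i 1) t) = extendCtrl T (Pi.single i 1) t := by
  unfold extendCtrl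
  split_ifs with h
  · rcases eq_or_ne (⟨t, h⟩ : Fin T) i with hi | hi <;> simp [hi]
  · simp

/-- the connecting operator is complex symmetric:
`(C^T)ᵀ = C^T`, equivalently `(C^T)^* = conj (C^T)` entrywise. -/
theorem connecting_operator_complex_symmetric
    (a b : ℕ → ℂ) (ha : ∀ n, a n ≠ 0)
    (U V : (ℕ → ℂ) → ℕ → ℤ → ℂ)
    (hU : ∀ f, IsWave a b f (U f))
    (hV : ∀ g, IsWave (fun n => (starRingEnd ℂ) (a n))
      (fun n => (starRingEnd ℂ) (b n)) g (V g))
    (T : ℕ) (hT : 1 ≤ T)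
    (C : Matrix (Fin T) (Fin T) ℂ)
    (hC : ∀ f g : Fin T → ℂ,
      ∑ k : Fin T, C.mulVec f k * (starRingEnd ℂ) (g k)
        = ∑ n : Fin T, U (extendCtrl T f) ((n : ℕ) + 1) (T : ℤ)
            * (starRingEnd ℂ) (V (extendCtrl T g) ((n : ℕ) + 1) (T : ℤ))) :
    Cᵀ = C ∧ Cᴴ = C.map (starRingEnd ℂ) := by
  have hconj (i : Fin T) (n : ℕ) :
      (starRingEnd ℂ) (V (extendCtrl T (Pi.single i 1)) n T) =
        U (extendCtrl T (Pi.single i 1)) n T := by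
    refine (IsWave.of_conj ?_).eq_of_isWave (hU _) T n
    simpa only [conj_extendCtrl_single] using hV (extendCtrl T (Pi.single i 1))
  have hentry (i j : Fin T) :
      C i j = ∑ n : Fin T, U (extendCtrl T (Pi.single j 1)) ((n : ℕ) + 1) T *
        U (extendCtrl T (Pi.single i 1)) ((n : ℕ) + 1) T := by
    have h := hC (Pi.single j 1) (Pi.single i 1)
    simp only [hconj] at h
    rw [← h, Finset.sum_eq_single i (fun k _ hk => by simp [hk]) (by simp)]
    simp
  have hsymm : Cᵀ = C := by
    ext i j
    rw [transpose_apply, hentry j i, hentry i j]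
    exact Finset.sum_congr rfl fun n _ => mul_comm _ _
  refine ⟨hsymm, ?_⟩
  rw [conjTranspose, hsymm]
  rfl
end
end
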